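/- Let Λ > 0, H > 0, C > 0 and 0 ≤ p ≤ 4. Let h ∈ C¹([0,∞)×[0,∞)) satisfy Dh = −(Λ/3) r (h − h̄) and |∂h/∂r (u,r)| ≤ C e^{−Hu} (1+r)^{−p} for all u, r ≥ 0. Then there is a constant C' (depending only on Λ, C and p) such that |∂h/∂u (u,r)| ≤ C' (1+r)^{n(p)} e^{−Hu} for all (u,r), where n(p) = 0 if 2 < p ≤ 4 and n(p) = 2 if 0 ≤ p ≤ 2. -/

import Mathlib

open Real Set

/-- The spherical mean `h̄(u,r) = (1/r) ∫₀^r h(u,s) ds`, with `h̄(u,0) = h(u,0)`. -/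
noncomputable def hbar (h : ℝ → ℝ → ℝ) (u r : ℝ) : ℝ :=
  if r = 0 then h u 0 else (∫ s in (0:ℝ)..r, h u s) / r

/-- Partial derivative in the `u` direction (within `[0,∞)`). -/
noncomputable def pderivU (h : ℝ → ℝ → ℝ) (u r : ℝ) : ℝ :=
  derivWithin (fun u' => h u' r) (Set.Ici 0) u

/-- Partial derivative in the `r` direction (within `[0,∞)`). -/
noncomputable def pderivR (h : ℝ → ℝ → ℝ) (u r : ℝ) : ℝ :=
  derivWithin (fun r' => h u r') (Set.Ici 0) r

/-- `h` solves `Dh = -(Λ/3) r (h - h̄)` on `[0,∞) × [0,∞)`. -/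
def IsSol (Λ : ℝ) (h : ℝ → ℝ → ℝ) : Prop :=
  ∀ u r : ℝ, 0 ≤ u → 0 ≤ r →
    pderivU h u r - (1/2) * (1 - Λ/3 * r^2) * pderivR h u r
      = -(Λ/3) * r * (h u r - hbar h u r)

/-- The exponent `n(p)`: `0` for `2 < p ≤ 4` and `2` for `0 ≤ p ≤ 2`. -/
noncomputable def nExp (p : ℝ) : ℝ := if 2 < p then 0 else 2

/-- `r (h - h̄)` equals `r h - ∫₀^r h`. -/
lemma mul_sub_hbar (h : ℝ → ℝ → ℝ) (u r : ℝ) :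
    r * (h u r - hbar h u r) = r * h u r - ∫ s in (0:ℝ)..r, h u s := by
  unfold hbar
  split_ifs with hr
  · simp [hr]
  · field_simp

/-- Any `B` with `B 0 ≥ 0` and `B' x ≥ x |g' x|` bounds `x g x - ∫₀^x g`, whose derivative is
`x g' x`. -/
lemma abs_mul_sub_integral_le {g g' B B' : ℝ → ℝ}
    (hg : ∀ x, 0 ≤ x → HasDerivWithinAt g (g' x) (Ici 0) x)
    (hB : ∀ x, 0 ≤ x → HasDerivAt B (B' x) x) (hB0 : 0 ≤ B 0)
    (hle : ∀ x, 0 ≤ x → x * |g' x| ≤ B' x) {r : ℝ} (hr : 0 ≤ r) :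
    |r * g r - ∫ s in (0:ℝ)..r, g s| ≤ B r := by
  have hgc : ContinuousOn g (Ici 0) := fun x hx => (hg x hx).continuousWithinAt
  have hgi : ∀ x, 0 ≤ x → IntervalIntegrable g MeasureTheory.volume 0 x := fun x hx =>
    (hgc.mono (by rw [uIcc_of_le hx]; exact Icc_subset_Ici_self)).intervalIntegrable
  have hder : ∀ x, 0 ≤ x →
      HasDerivWithinAt (fun x => x * g x - ∫ s in (0:ℝ)..x, g s) (x * g' x) (Ici x) x := by
    intro x hx
    have h1 : HasDerivWithinAt (fun x => ∫ s in (0:ℝ)..x, g s) (g x) (Ici x) x := by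
      refine intervalIntegral.integral_hasDerivWithinAt_right (t := Ioi x) (hgi x hx) ?_ ?_
      · refine ⟨Ioi x, self_mem_nhdsWithin, ?_⟩
        exact (hgc.mono fun y hy => hx.trans (le_of_lt hy)).aestronglyMeasurable measurableSet_Ioi
      · exact (hgc x hx).mono fun y hy => hx.trans (le_of_lt hy)
    have h2 := (hasDerivWithinAt_id x (Ici x)).mul ((hg x hx).mono (Ici_subset_Ici.2 hx))
    exact (h2.sub h1).congr_deriv (by simp)
  have hcont : ContinuousOn (fun x => x * g x - ∫ s in (0:ℝ)..x, g s) (Icc 0 r) := by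
    refine (continuousOn_id.mul (hgc.mono Icc_subset_Ici_self)).sub ?_
    have := intervalIntegral.continuousOn_primitive_interval (μ := MeasureTheory.volume)
      (f := g) (a := 0) (b := r) (by
        rw [uIcc_of_le hr]
        exact (hgc.mono Icc_subset_Ici_self).integrableOn_Icc)
    rwa [uIcc_of_le hr] at this
  refine image_norm_le_of_norm_deriv_right_le_deriv_boundary' hcont (fun x hx => hder x hx.1)
    (by simpa using hB0) (fun x hx => (hB x hx.1).continuousAt.continuousWithinAt)
    (fun x hx => (hB x hx.1).hasDerivWithinAt) (fun x hx => ?_) (right_mem_Icc.2 hr)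
  rw [norm_mul, norm_eq_abs, norm_eq_abs, abs_of_nonneg hx.1]
  exact hle x hx.1

lemma abs_mul_sub_integral_le_sq {g g' : ℝ → ℝ} {K p : ℝ} (hp : 0 ≤ p) (hK : 0 ≤ K)
    (hg : ∀ x, 0 ≤ x → HasDerivWithinAt g (g' x) (Ici 0) x)
    (hle : ∀ x, 0 ≤ x → |g' x| ≤ K * (1 + x) ^ (-p)) {r : ℝ} (hr : 0 ≤ r) :
    |r * g r - ∫ s in (0:ℝ)..r, g s| ≤ K * r ^ 2 := by
  refine abs_mul_sub_integral_le (B := fun x => K * x ^ 2) (B' := fun x => K * (2 * x)) hg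
    (fun x _ => ?_) (by simp) (fun x hx => ?_) hr
  · simpa using (hasDerivAt_pow 2 x).const_mul K
  · have h1 : (1 + x) ^ (-p) ≤ 1 := rpow_le_one_of_one_le_of_nonpos (by linarith) (by linarith)
    have h2 : |g' x| ≤ K := (hle x hx).trans (mul_le_of_le_one_right hK h1)
    nlinarith [mul_nonneg hK hx]

lemma abs_mul_sub_integral_le_const {g g' : ℝ → ℝ} {K p : ℝ} (hp : 2 < p) (hK : 0 ≤ K)
    (hg : ∀ x, 0 ≤ x → HasDerivWithinAt g (g' x) (Ici 0) x)
    (hle : ∀ x, 0 ≤ x → |g' x| ≤ K * (1 + x) ^ (-p)) {r : ℝ} (hr : 0 ≤ r) :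
    |r * g r - ∫ s in (0:ℝ)..r, g s| ≤ K / (p - 2) := by
  have hp' : 0 < p - 2 := by linarith
  refine (abs_mul_sub_integral_le (B := fun x => K / (p - 2) * (1 - (1 + x) ^ (2 - p)))
    (B' := fun x => K * (1 + x) ^ (1 - p)) hg (fun x hx => ?_) (by simp)
    (fun x hx => ?_) hr).trans ?_
  · have h1 : HasDerivAt (fun x : ℝ => (1 + x) ^ (2 - p)) (1 * (2 - p) * (1 + x) ^ (2 - p - 1)) x :=
      ((hasDerivAt_id x).const_add 1).rpow_const (Or.inl (by simp; linarith))
    refine ((h1.const_sub 1).const_mul (K / (p - 2))).congr_deriv ?_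
    rw [show 2 - p - 1 = 1 - p by ring]
    field_simp
    ring
  · have h1 : (1 + x) ^ (1 - p) = (1 + x) * (1 + x) ^ (-p) := by
      rw [sub_eq_add_neg, rpow_add (by linarith), rpow_one]
    have h2 : 0 ≤ K * (1 + x) ^ (-p) := mul_nonneg hK (rpow_nonneg (by linarith) _)
    rw [h1]
    nlinarith [mul_le_mul_of_nonneg_left (hle x hx) hx]
  · have : 0 ≤ (1 + r) ^ (2 - p) := rpow_nonneg (by linarith) _
    exact mul_le_of_le_one_right (div_nonneg hK hp'.le) (by linarith)

/-- The radial weight of the transport term is controlled by `(1 + r)^n(p)`. -/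
lemma one_add_sq_mul_rpow_neg_le {p r : ℝ} (hp : 0 ≤ p) (hr : 0 ≤ r) :
    (1 + r) ^ 2 * (1 + r) ^ (-p) ≤ (1 + r) ^ nExp p := by
  rw [← rpow_natCast, ← rpow_add (by linarith)]
  refine rpow_le_rpow_of_exponent_le (by linarith) ?_
  unfold nExp
  split_ifs <;> push_cast <;> linarith

/-- If `h ∈ C¹([0,∞)²)` satisfies `Dh = -(Λ/3) r (h - h̄)` and
`|∂_r h(u,r)| ≤ C e^{-Hu} (1+r)^{-p}` with `0 ≤ p ≤ 4`, then there is `C'` (depending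
only on `Λ`, `C` and `p`) such that `|∂_u h(u,r)| ≤ C' (1+r)^{n(p)} e^{-Hu}`. -/
theorem time_derivative_decay
    (Λ C p : ℝ) (hΛ : 0 < Λ) (hC : 0 < C) (hp0 : 0 ≤ p) (hp4 : p ≤ 4) :
    ∃ C' : ℝ, 0 < C' ∧
      ∀ (H : ℝ), 0 < H →
      ∀ h : ℝ → ℝ → ℝ,
        ContDiffOn ℝ 1 (fun q : ℝ × ℝ => h q.1 q.2) (Set.Ici 0 ×ˢ Set.Ici 0) →
        IsSol Λ h →
        (∀ u r : ℝ, 0 ≤ u → 0 ≤ r →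
          |pderivR h u r| ≤ C * Real.exp (-H * u) * (1 + r) ^ (-p)) →
        ∀ u r : ℝ, 0 ≤ u → 0 ≤ r →
          |pderivU h u r| ≤ C' * (1 + r) ^ (nExp p) * Real.exp (-H * u) := by
  obtain ⟨D, hD, hmean⟩ : ∃ D : ℝ, 0 < D ∧ ∀ (K : ℝ) (g g' : ℝ → ℝ), 0 ≤ K →
      (∀ x, 0 ≤ x → HasDerivWithinAt g (g' x) (Ici 0) x) →
      (∀ x, 0 ≤ x → |g' x| ≤ K * (1 + x) ^ (-p)) → ∀ r, 0 ≤ r →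
      |r * g r - ∫ s in (0:ℝ)..r, g s| ≤ K * D * (1 + r) ^ nExp p := by
    by_cases hp : 2 < p
    · refine ⟨1 / (p - 2), by simpa using hp, fun K g g' hK hg hle r hr => ?_⟩
      have := abs_mul_sub_integral_le_const hp hK hg hle hr
      simpa [nExp, hp, div_eq_mul_inv] using this
    · refine ⟨1, one_pos, fun K g g' hK hg hle r hr => ?_⟩
      refine (abs_mul_sub_integral_le_sq hp0 hK hg hle hr).trans ?_
      rw [nExp, if_neg hp, rpow_two, mul_one]
      gcongr
      linarith
  refine ⟨C * (1 + Λ / 3) + Λ / 3 * (C * D), by positivity, ?_⟩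
  intro H _ h hh hsol hbound u r hu hr
  have hg : ∀ x, 0 ≤ x → HasDerivWithinAt (h u) (pderivR h u x) (Ici 0) x := by
    intro x hx
    refine DifferentiableWithinAt.hasDerivWithinAt ?_
    have h1 := hh.differentiableOn one_ne_zero (u, x) ⟨hu, hx⟩
    have h2 : DifferentiableWithinAt ℝ (fun y : ℝ => (u, y)) (Ici 0) x := by fun_prop
    exact h1.comp x h2 fun y hy => ⟨hu, hy⟩
  have hF := hmean (C * exp (-H * u)) (h u) (pderivR h u) (by positivity) hg
    (fun x hx => hbound u x hu hx) r hr
  rw [← mul_sub_hbar] at hF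
  have hw := one_add_sq_mul_rpow_neg_le hp0 hr
  have hcoef : |1 / 2 * (1 - Λ / 3 * r ^ 2)| ≤ (1 + Λ / 3) * (1 + r) ^ 2 := by
    have h1 : 0 ≤ Λ * r ^ 2 := by positivity
    have h2 : 0 ≤ Λ * r := by positivity
    rw [abs_le]
    constructor <;> nlinarith [sq_nonneg r]
  have heq : pderivU h u r = 1 / 2 * (1 - Λ / 3 * r ^ 2) * pderivR h u r
      - Λ / 3 * (r * (h u r - hbar h u r)) := by
    linarith [hsol u r hu hr]
  calc |pderivU h u r|
      ≤ |1 / 2 * (1 - Λ / 3 * r ^ 2)| * |pderivR h u r|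
        + Λ / 3 * |r * (h u r - hbar h u r)| := by
        rw [heq]
        refine (abs_sub _ _).trans ?_
        rw [abs_mul, abs_mul (Λ / 3), abs_of_pos (show 0 < Λ / 3 by positivity)]
    _ ≤ (1 + Λ / 3) * (1 + r) ^ 2 * (C * exp (-H * u) * (1 + r) ^ (-p))
        + Λ / 3 * (C * exp (-H * u) * D * (1 + r) ^ nExp p) := by
        gcongr
        exact hbound u r hu hr
    _ = (1 + Λ / 3) * (C * exp (-H * u)) * ((1 + r) ^ 2 * (1 + r) ^ (-p))
        + Λ / 3 * (C * exp (-H * u) * D * (1 + r) ^ nExp p) := by ring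
    _ ≤ (1 + Λ / 3) * (C * exp (-H * u)) * (1 + r) ^ nExp p
        + Λ / 3 * (C * exp (-H * u) * D * (1 + r) ^ nExp p) := by gcongr
    _ = _ := by ring
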